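/- arXiv:2404.04773 — 5 statements merged into one kernel-verified Lean document; each statement's English description precedes it below -/
import Mathlib

section
/- Let n ∈ ℕ, let v : Fin n → ℝ satisfy v_i ≥ 0 for all i, and let T ≥ 0. Define m_i := min(v_i, max(T − Σ_{l < i} v_l, 0)) for each i. Then Σ_{i} m_i = min(Σ_{i} v_i, T). -/
theorem stmt1 (n : ℕ) (v : Fin n → ℝ) (hv : ∀ i, 0 ≤ v i) (T : ℝ) (hT : 0 ≤ T) :
    ∑ i, min (v i) (max (T - ∑ l ∈ Finset.Iio i, v l) 0) = min (∑ i, v i) T := by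
  induction n with
  | zero => simpa using hT
  | succ n ih =>
    have hlast : ∑ l ∈ Finset.Iio (Fin.last n), v l = ∑ i : Fin n, v i.castSucc := by
      rw [Fin.Iio_last_eq_map, Finset.sum_map]
      rfl
    have hcast (i : Fin n) : ∑ l ∈ Finset.Iio i.castSucc, v l =
        ∑ l ∈ Finset.Iio i, v l.castSucc := by
      rw [← Fin.map_castSuccEmb_Iio, Finset.sum_map]
      rfl
    simp only [Fin.sum_univ_castSucc, hlast, hcast]
    rw [ih (fun i => v i.castSucc) fun i => hv i.castSucc]
    have := hv (Fin.last n)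
    grind
end

section
/- Let G be a finite tree (a connected acyclic simple graph) on a nonempty vertex set V, and let V be partitioned into two sets A and B such that every edge of G joins a vertex of A to a vertex of B. If every vertex of A has degree at least 2 in G, then |B| ≥ |A| + 1. -/
theorem stmt5 {V : Type*} [Fintype V] [DecidableEq V] (G : SimpleGraph V)
    [DecidableRel G.Adj] (hT : G.IsTree) (A B : Finset V)
    (hcover : ∀ v, v ∈ A ∨ v ∈ B) (hdisj : ∀ v, ¬(v ∈ A ∧ v ∈ B))
    (hedge : ∀ u v, G.Adj u v → (u ∈ A ∧ v ∈ B) ∨ (u ∈ B ∧ v ∈ A))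
    (hdeg : ∀ v ∈ A, 2 ≤ G.degree v) :
    A.card + 1 ≤ B.card := by
  have hAB : Disjoint A B := Finset.disjoint_left.mpr fun v hA hB => hdisj v ⟨hA, hB⟩
  have hbip : G.IsBipartiteWith A B :=
    ⟨Finset.disjoint_coe.mpr hAB, fun u v h => hedge u v h⟩
  have hsum := SimpleGraph.isBipartiteWith_sum_degrees_eq_card_edges hbip
  have hle : A.card * 2 ≤ ∑ v ∈ A, G.degree v := by
    simpa using Finset.card_nsmul_le_sum A (fun v => G.degree v) 2 hdeg
  have hcard : A.card + B.card = Fintype.card V := by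
    rw [← Finset.card_union_of_disjoint hAB, ← Finset.card_univ]
    congr 1
    ext v
    simpa using hcover v
  have htree := hT.card_edgeFinset
  omega
end

section
/- Let n ∈ ℕ, let p : Fin n → ℝ be positive, and let σ : Fin n → ℝ satisfy σ_1 ≥ σ_2 ≥ ... ≥ σ_n ≥ 0; set σ_{n+1} := 0. For each subset f ⊆ Fin n define cost(f) := Σ_{j ∈ f} σ_j p_j · (Σ_{j' ∈ f, j' ≤ j} p_{j'}), and for a subset S define p(S) := Σ_{j ∈ S} p_j. Let y : Finset (Fin n) → ℝ be nonnegative, and define z_j := Σ_{f ∋ j} y_f. Then Σ_f y_f · cost(f) = Σ_{j* = 1}^{n} (σ_{j*} − σ_{j*+1}) · ½·(Σ_{j ≤ j*} z_j p_j² + Σ_f y_f · p(f ∩ [j*])²), where [j*] := {1, ..., j*}. -/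
/-- The ordered pairs `i ≤ j` contribute half of the square of the sum plus half of the diagonal. -/
theorem Finset.sum_mul_sum_filter_le {ι : Type*} [LinearOrder ι] (p : ι → ℝ) (s : Finset ι) :
    ∑ j ∈ s, p j * ∑ i ∈ s with i ≤ j, p i =
      1 / 2 * (∑ j ∈ s, p j ^ 2 + (∑ j ∈ s, p j) ^ 2) := by
  induction s using Finset.induction_on_max with
  | empty => simp
  | insert a s ha ih =>
    have hna : a ∉ s := fun h => lt_irrefl _ (ha a h)
    have htop : (insert a s).filter (fun i => i ≤ a) = insert a s :=
      Finset.filter_true_of_mem fun i hi => by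
        rcases Finset.mem_insert.1 hi with rfl | hi
        exacts [le_rfl, (ha i hi).le]
    have hrest : ∑ j ∈ s, p j * ∑ i ∈ insert a s with i ≤ j, p i =
        ∑ j ∈ s, p j * ∑ i ∈ s with i ≤ j, p i :=
      Finset.sum_congr rfl fun j hj => by
        rw [Finset.filter_insert, if_neg (not_le.2 (ha j hj))]
    rw [Finset.sum_insert hna, htop, hrest, ih, Finset.sum_insert hna, Finset.sum_insert hna]
    ring

/-- A finite sequence, continued by `0`, is the tail sum of its consecutive differences. -/
theorem Fin.sum_Ici_sub_succ {n : ℕ} (σ σ' : Fin n → ℝ)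
    (hσ' : ∀ j : Fin n, σ' j = if h : (j : ℕ) + 1 < n then σ ⟨(j : ℕ) + 1, h⟩ else 0)
    (j : Fin n) : ∑ k ∈ Finset.Ici j, (σ k - σ' k) = σ j := by
  let s : ℕ → ℝ := fun i => if h : i < n then σ ⟨i, h⟩ else 0
  have hs : ∀ k : Fin n, σ k = s k := fun k => by simp [s]
  have hmap : ∑ k ∈ Finset.Ici j, (σ k - σ' k) = ∑ i ∈ Finset.Ico (j : ℕ) n, (s i - s (i + 1)) := by
    rw [← Fin.map_valEmbedding_Ici, Finset.sum_map]
    exact Finset.sum_congr rfl fun k _ => by rw [hs k, hσ' k]; rfl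
  have htel := Finset.sum_Ico_sub s j.isLt.le
  have hneg : ∑ i ∈ Finset.Ico (j : ℕ) n, (s i - s (i + 1)) =
      -∑ i ∈ Finset.Ico (j : ℕ) n, (s (i + 1) - s i) := by
    rw [← Finset.sum_neg_distrib]
    exact Finset.sum_congr rfl fun i _ => by ring
  have hn : s n = 0 := by simp [s]
  rw [hmap, hneg, htel, hs j, hn]
  ring

/-- The cost of a configuration, decomposed along the differences of the Smith ratios. -/
theorem sum_smith_cost_eq {n : ℕ} (p σ δ : Fin n → ℝ)
    (hδ : ∀ j, ∑ k ∈ Finset.Ici j, δ k = σ j) (f : Finset (Fin n)) :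
    ∑ j ∈ f, σ j * p j * ∑ i ∈ f with i ≤ j, p i =
      ∑ k, δ k * (1 / 2 * (∑ j ∈ f ∩ Finset.Iic k, p j ^ 2 +
        (∑ j ∈ f ∩ Finset.Iic k, p j) ^ 2)) := by
  have hinner : ∀ k, ∀ j ∈ f ∩ Finset.Iic k,
      (f ∩ Finset.Iic k).filter (fun i => i ≤ j) = f.filter (fun i => i ≤ j) := by
    intro k j hj
    have hjk : j ≤ k := by simpa using (Finset.mem_inter.1 hj).2
    ext i
    simp only [Finset.mem_filter, Finset.mem_inter, Finset.mem_Iic]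
    exact ⟨fun h => ⟨h.1.1, h.2⟩, fun h => ⟨⟨h.1, h.2.trans hjk⟩, h.2⟩⟩
  calc ∑ j ∈ f, σ j * p j * ∑ i ∈ f with i ≤ j, p i
      = ∑ j ∈ f, ∑ k ∈ Finset.Ici j, δ k * (p j * ∑ i ∈ f with i ≤ j, p i) :=
        Finset.sum_congr rfl fun j _ => by rw [← Finset.sum_mul, hδ, mul_assoc]
    _ = ∑ k, ∑ j ∈ f ∩ Finset.Iic k, δ k * (p j * ∑ i ∈ f with i ≤ j, p i) :=
        Finset.sum_comm' (by simp)
    _ = _ := Finset.sum_congr rfl fun k _ => by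
        rw [← Finset.sum_mul_sum_filter_le, Finset.mul_sum]
        exact Finset.sum_congr rfl fun j hj => by rw [hinner k j hj]

theorem stmt6 (n : ℕ) (p : Fin n → ℝ) (hp : ∀ j, 0 < p j)
    (σ : Fin n → ℝ) (hσ : Antitone σ) (hσ0 : ∀ j, 0 ≤ σ j)
    (y : Finset (Fin n) → ℝ) (hy : ∀ f, 0 ≤ y f)
    (z : Fin n → ℝ) (hz : ∀ j, z j = ∑ f ∈ Finset.univ.filter (fun f => j ∈ f), y f)
    (σ' : Fin n → ℝ)
    (hσ' : ∀ j : Fin n, σ' j = if h : (j : ℕ) + 1 < n then σ ⟨(j : ℕ) + 1, h⟩ else 0) :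
    ∑ f, y f * (∑ j ∈ f, σ j * p j * ∑ j' ∈ f.filter (fun j' => j' ≤ j), p j') =
      ∑ jstar, (σ jstar - σ' jstar) *
        (1 / 2 * (∑ j ∈ Finset.Iic jstar, z j * p j ^ 2 +
          ∑ f, y f * (∑ j ∈ f ∩ Finset.Iic jstar, p j) ^ 2)) := by
  have hzsum : ∀ k, ∑ j ∈ Finset.Iic k, z j * p j ^ 2 =
      ∑ f, y f * ∑ j ∈ f ∩ Finset.Iic k, p j ^ 2 := by
    intro k
    simp only [hz, Finset.sum_mul, Finset.mul_sum]
    exact Finset.sum_comm' (by simp [and_comm])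
  simp only [sum_smith_cost_eq p σ (fun k => σ k - σ' k) (Fin.sum_Ici_sub_succ σ σ' hσ'),
    Finset.mul_sum (s := (Finset.univ : Finset (Fin n)))]
  rw [Finset.sum_comm]
  refine Finset.sum_congr rfl fun k _ => ?_
  rw [hzsum, ← Finset.sum_add_distrib, Finset.mul_sum, Finset.mul_sum]
  exact Finset.sum_congr rfl fun f _ => by ring
end

section
/- Let J be a finite set, p : J → ℝ positive, and y : Finset J → ℝ nonnegative with Σ_f y_f = 1. Define z_j := Σ_{f ∋ j} y_f, and for S ⊆ J define vol(S) := Σ_{j ∈ S} z_j p_j. For β ∈ [1, 2) and k ∈ ℤ define J_k(β) := {j ∈ J : β·2^k ≤ p_j < β·2^{k+1}}. Then (1/ln 2) · ∫_{1}^{2} [ Σ_{j ∈ J} z_j p_j² + ½·vol(J)² − ½·Σ_{k ∈ ℤ} (min(vol(J_k(β)), β·2^k))² ] · (1/β) dβ ≤ 1.36 · ½ · ( Σ_{j ∈ J} z_j p_j² + Σ_f y_f · (Σ_{j ∈ f} p_j)² ). -/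
open scoped Classical

open MeasureTheory

section Configurations

/-- The extremal lower bound on the squared load of a configuration, in terms of a level `θ`. -/
lemma sum_mul_level_le_sq {J : Type*} (p : J → ℝ) (hp : ∀ j, 0 < p j) {θ : ℝ} (hθ : 0 ≤ θ)
    (f : Finset J) :
    ∑ j ∈ f, p j * (max θ (p j) + θ ^ 2 / max θ (p j)) - θ ^ 2 ≤ (∑ j ∈ f, p j) ^ 2 := by
  set S := ∑ j ∈ f, p j with hS
  have hmono : ∀ j ∈ f, max θ (p j) + θ ^ 2 / max θ (p j) ≤ max θ S + θ ^ 2 / max θ S := by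
    intro j hj
    have hjS : p j ≤ S := Finset.single_le_sum (fun i _ => (hp i).le) hj
    have ha : 0 < max θ (p j) := lt_max_of_lt_right (hp j)
    have hab : max θ (p j) ≤ max θ S := max_le_max le_rfl hjS
    have hb : 0 < max θ S := ha.trans_le hab
    have hθa : θ ≤ max θ (p j) := le_max_left _ _
    have hθb : θ ≤ max θ S := le_max_left _ _
    generalize max θ (p j) = a at *
    generalize max θ S = b at *
    have h : b + θ ^ 2 / b - (a + θ ^ 2 / a) = (b - a) * (a * b - θ ^ 2) / (a * b) := by
      field_simp
      ring
    have h2 : 0 ≤ (b - a) * (a * b - θ ^ 2) / (a * b) := by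
      apply div_nonneg _ (by positivity)
      apply mul_nonneg (by linarith)
      nlinarith
    linarith
  have h1 : ∑ j ∈ f, p j * (max θ (p j) + θ ^ 2 / max θ (p j))
      ≤ S * (max θ S + θ ^ 2 / max θ S) := by
    rw [hS, Finset.sum_mul, ← hS]
    exact Finset.sum_le_sum fun j hj => mul_le_mul_of_nonneg_left (hmono j hj) (hp j).le
  have hS0 : 0 ≤ S := Finset.sum_nonneg fun j _ => (hp j).le
  have h2 : S * (max θ S + θ ^ 2 / max θ S) ≤ S ^ 2 + θ ^ 2 := by
    rcases le_total S θ with h | h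
    · rw [max_eq_left h]
      rcases hθ.eq_or_lt with h0 | h0
      · subst h0
        nlinarith
      · have : θ ^ 2 / θ = θ := by field_simp
        rw [this]
        nlinarith [sq_nonneg (S - θ)]
    · rw [max_eq_right h]
      rcases hS0.eq_or_lt with h0 | h0
      · rw [← h0]
        nlinarith [sq_nonneg θ]
      · apply le_of_eq
        field_simp
  linarith

/-- The level at which the fractional configurations are balanced. -/
lemma exists_level {J : Type*} [Fintype J] (p : J → ℝ) (hp : ∀ j, 0 < p j)
    (z : J → ℝ) (hV : 0 < ∑ j, z j * p j) (hz : ∀ j, 0 ≤ z j) :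
    ∃ θ : ℝ, 0 ≤ θ ∧ ∑ j, z j * p j / max θ (p j) ≤ 1 ∧
      (θ = 0 ∨ ∑ j, z j * p j / max θ (p j) = 1) := by
  have h0 : ∀ j, max 0 (p j) = p j := fun j => max_eq_right (hp j).le
  by_cases h : ∑ j, z j * p j / max 0 (p j) ≤ 1
  · exact ⟨0, le_rfl, h, Or.inl rfl⟩
  · push Not at h
    set V := ∑ j, z j * p j with hVdef
    have hcont : Continuous fun θ : ℝ => ∑ j, z j * p j / max θ (p j) := by
      refine continuous_finsetSum _ fun j _ => ?_
      refine Continuous.div (by fun_prop) (by fun_prop) fun θ => ?_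
      exact (lt_max_of_lt_right (hp j)).ne'
    have hVle : ∑ j, z j * p j / max V (p j) ≤ 1 := by
      calc ∑ j, z j * p j / max V (p j) ≤ ∑ j, z j * p j / V := by
            refine Finset.sum_le_sum fun j _ => ?_
            exact div_le_div_of_nonneg_left (mul_nonneg (hz j) (hp j).le) hV (le_max_left _ _)
        _ = 1 := by rw [← Finset.sum_div, ← hVdef, div_self hV.ne']
    obtain ⟨θ, hθ, hθ1⟩ := intermediate_value_Icc' hV.le hcont.continuousOn ⟨hVle, h.le⟩
    exact ⟨θ, hθ.1, hθ1.le, Or.inr hθ1⟩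

end Configurations

section Windows

/-- The total weight of the jobs whose size lies in `[u, 2u)`. -/
noncomputable def windowMass {J : Type*} [Fintype J] (p w : J → ℝ) (u : ℝ) : ℝ :=
  ∑ j, if u ≤ p j ∧ p j < 2 * u then w j else 0

variable {J : Type*} [Fintype J]

lemma measurable_windowMass (p w : J → ℝ) : Measurable (windowMass p w) := by
  unfold windowMass
  refine Finset.measurable_fun_sum _ fun j _ => ?_
  refine Measurable.ite ?_ measurable_const measurable_const
  exact (measurableSet_le measurable_id measurable_const).inter
    (measurableSet_lt measurable_const (measurable_const.mul measurable_id))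

lemma windowMass_nonneg (p w : J → ℝ) (hw : ∀ j, 0 ≤ w j) (u : ℝ) : 0 ≤ windowMass p w u :=
  Finset.sum_nonneg fun j _ => by split_ifs <;> simp [hw]

lemma windowMass_mono (p : J → ℝ) {w w' : J → ℝ} (h : ∀ j, w j ≤ w' j) (u : ℝ) :
    windowMass p w u ≤ windowMass p w' u :=
  Finset.sum_le_sum fun j _ => by split_ifs <;> simp [h]

lemma windowMass_eq_zero_of_lt (p w : J → ℝ) {u : ℝ} (h : ∀ j, p j < u) :
    windowMass p w u = 0 :=
  Finset.sum_eq_zero fun j _ => if_neg fun hj => absurd hj.1 (not_le.2 (h j))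

lemma windowMass_eq_zero_of_le (p w : J → ℝ) {u : ℝ} (h : ∀ j, 2 * u ≤ p j) :
    windowMass p w u = 0 :=
  Finset.sum_eq_zero fun j _ => if_neg fun hj => absurd hj.2 (not_lt.2 (h j))

lemma windowMass_size_le (p η : J → ℝ) (hη : ∀ j, 0 ≤ η j) (hη1 : ∑ j, η j ≤ 1) {u : ℝ}
    (hu : 0 ≤ u) : windowMass p (fun j => p j * η j) u ≤ 2 * u := by
  calc windowMass p (fun j => p j * η j) u ≤ ∑ j, 2 * u * η j := by
        refine Finset.sum_le_sum fun j _ => ?_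
        split_ifs with h
        · exact mul_le_mul_of_nonneg_right h.2.le (hη j)
        · exact mul_nonneg (by positivity) (hη j)
    _ = 2 * u * ∑ j, η j := by rw [Finset.mul_sum]
    _ ≤ 2 * u := by nlinarith

/-- The truncated square of the weight of a window, with respect to `du / u`. -/
noncomputable def cappedSq (p w : J → ℝ) (u : ℝ) : ℝ := min (windowMass p w u) u ^ 2

lemma measurable_cappedSq (p w : J → ℝ) : Measurable (cappedSq p w) :=
  ((measurable_windowMass p w).min measurable_id).pow_const 2

lemma cappedSq_le (p w : J → ℝ) (hw : ∀ j, 0 ≤ w j) {u : ℝ} (hu : 0 ≤ u) :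
    cappedSq p w u ≤ u ^ 2 :=
  pow_le_pow_left₀ (le_min (windowMass_nonneg p w hw u) hu) (min_le_right _ _) 2

lemma cappedSq_eq_zero (p w : J → ℝ) {u : ℝ} (hu : 0 ≤ u) (h : windowMass p w u = 0) :
    cappedSq p w u = 0 := by
  simp [cappedSq, h, hu]

lemma intervalIntegrable_cappedSq_mul (p w : J → ℝ) (hw : ∀ j, 0 ≤ w j) {a b c : ℝ} (ha : 0 < a)
    (hb : 0 < b) (hc : 0 < c) :
    IntervalIntegrable (fun u => cappedSq p w (u * c) * (1 / u)) volume a b := by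
  have hbound : IntervalIntegrable (fun u : ℝ => u * c ^ 2) volume a b :=
    (continuous_id.mul continuous_const).intervalIntegrable _ _
  refine hbound.mono_fun ?_ ?_
  · exact (((measurable_cappedSq p w).comp (measurable_id.mul_const c)).mul
      (measurable_const.div measurable_id)).aestronglyMeasurable
  · refine (ae_restrict_iff' measurableSet_uIoc).2 (Filter.Eventually.of_forall fun u hu => ?_)
    have hu0 : 0 < u := (lt_min ha hb).trans hu.1
    have h1 := cappedSq_le p w hw (u := u * c) (by positivity)
    have h2 : 0 ≤ cappedSq p w (u * c) := sq_nonneg _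
    change ‖cappedSq p w (u * c) * (1 / u)‖ ≤ ‖u * c ^ 2‖
    rw [Real.norm_of_nonneg (by positivity), Real.norm_of_nonneg (by positivity), mul_one_div, div_le_iff₀ hu0]
    nlinarith

/-- Averaging over a logarithmically uniform shift unfolds to an integral over all scales. -/
lemma exists_integral_tsum_cappedSq (p w : J → ℝ) (hp : ∀ j, 0 < p j) (hw : ∀ j, 0 ≤ w j)
    {δ X : ℝ} (hδ : 0 < δ) :
    ∃ ε T : ℝ, 0 < ε ∧ ε ≤ δ ∧ X ≤ T ∧
      IntervalIntegrable (fun β : ℝ => (∑' k : ℤ, cappedSq p w (β * 2 ^ k)) * (1 / β))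
        volume 1 2 ∧
      ∫ β in (1 : ℝ)..2, (∑' k : ℤ, cappedSq p w (β * 2 ^ k)) * (1 / β) =
        ∫ u in ε..T, cappedSq p w u * (1 / u) := by
  obtain ⟨n, hnp, hnp', hnX, hnδ⟩ : ∃ n : ℕ, (∀ j, p j < 2 ^ n) ∧
      (∀ j, (1 / 2 : ℝ) ^ n < p j / 2) ∧ X < 2 ^ n ∧ (1 / 2 : ℝ) ^ n < δ := by
    have hup := tendsto_pow_atTop_atTop_of_one_lt (one_lt_two (α := ℝ))
    have hdown := tendsto_pow_atTop_nhds_zero_of_lt_one (r := (1 / 2 : ℝ)) (by norm_num)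
      (by norm_num)
    exact ((Filter.eventually_all.2 fun j => hup.eventually_gt_atTop (p j)).and
      ((Filter.eventually_all.2 fun j => hdown.eventually_lt_const (half_pos (hp j))).and
        ((hup.eventually_gt_atTop X).and (hdown.eventually_lt_const hδ)))).exists
  have hneg : (2 : ℝ) ^ (-(n : ℤ)) = (1 / 2) ^ n := by
    rw [zpow_neg, zpow_natCast, one_div, inv_pow]
  have htsum : ∀ β ∈ Set.Icc (1 : ℝ) 2, ∑' k : ℤ, cappedSq p w (β * 2 ^ k) =
      ∑ k ∈ Finset.Ico (-(n : ℤ)) n, cappedSq p w (β * 2 ^ k) := by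
    intro β hβ
    have hβ0 : 0 < β := one_pos.trans_le hβ.1
    refine tsum_eq_sum fun k hk => cappedSq_eq_zero p w (by positivity) ?_
    rw [Finset.mem_Ico, not_and_or, not_le, not_lt] at hk
    have hk0 : (0 : ℝ) < 2 ^ k := by positivity
    rcases hk with hk | hk
    · refine windowMass_eq_zero_of_le p w fun j => ?_
      have h1 : (2 : ℝ) ^ (k + 1) ≤ 2 ^ (-(n : ℤ)) := zpow_le_zpow_right₀ one_le_two (by omega)
      rw [zpow_add_one₀ two_ne_zero, hneg] at h1
      have h2 := hnp' j
      nlinarith [hβ.2]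
    · refine windowMass_eq_zero_of_lt p w fun j => ?_
      have h1 : (2 : ℝ) ^ (n : ℤ) ≤ 2 ^ k := zpow_le_zpow_right₀ one_le_two hk
      rw [zpow_natCast] at h1
      have h2 := hnp j
      nlinarith [hβ.1]
  have hcongr : Set.EqOn (fun β : ℝ => ∑ k ∈ Finset.Ico (-(n : ℤ)) n,
      cappedSq p w (β * 2 ^ k) * (1 / β))
      (fun β : ℝ => (∑' k : ℤ, cappedSq p w (β * 2 ^ k)) * (1 / β)) (Set.uIcc 1 2) := by
    intro β hβ
    rw [Set.uIcc_of_le one_le_two] at hβ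
    simp only [htsum β hβ, Finset.sum_mul]
  have hterm : ∀ k : ℤ, IntervalIntegrable
      (fun β : ℝ => cappedSq p w (β * 2 ^ k) * (1 / β)) volume 1 2 := fun k =>
    intervalIntegrable_cappedSq_mul p w hw one_pos two_pos (by positivity)
  refine ⟨(1 / 2) ^ n, 2 ^ n, by positivity, hnδ.le, hnX.le, ?_, ?_⟩
  · refine IntervalIntegrable.congr (hcongr.mono Set.uIoc_subset_uIcc) ?_
    simpa only [Finset.sum_fn] using
      IntervalIntegrable.sum (Finset.Ico (-(n : ℤ)) n) fun k _ => hterm k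
  · rw [← intervalIntegral.integral_congr hcongr,
      intervalIntegral.integral_finsetSum fun k _ => hterm k]
    have hint : ∀ k l : ℤ, IntervalIntegrable (fun u => cappedSq p w u * (1 / u)) volume
        ((2 : ℝ) ^ k) (2 ^ l) := fun k l => by
      simpa using intervalIntegrable_cappedSq_mul p w hw (a := 2 ^ k) (b := 2 ^ l)
        (by positivity) (by positivity) one_pos
    have hsub : ∀ k l : ℤ, (∫ u in (2 : ℝ) ^ k..2 ^ (0 : ℤ), cappedSq p w u * (1 / u)) -
        ∫ u in (2 : ℝ) ^ l..2 ^ (0 : ℤ), cappedSq p w u * (1 / u) =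
        ∫ u in (2 : ℝ) ^ k..2 ^ l, cappedSq p w u * (1 / u) := fun k l =>
      sub_eq_of_eq_add (intervalIntegral.integral_add_adjacent_intervals (hint _ _) (hint _ _)).symm
    have hscale : ∀ k : ℤ, ∫ β in (1 : ℝ)..2, cappedSq p w (β * 2 ^ k) * (1 / β) =
        (∫ u in (2 : ℝ) ^ k..2 ^ (0 : ℤ), cappedSq p w u * (1 / u)) -
          ∫ u in (2 : ℝ) ^ (k + 1)..2 ^ (0 : ℤ), cappedSq p w u * (1 / u) := by
      intro k
      have hk0 : (2 : ℝ) ^ k ≠ 0 := by positivity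
      rw [hsub]
      have h := intervalIntegral.mul_integral_comp_mul_right
        (f := fun u => cappedSq p w u * (1 / u)) (a := 1) (b := 2) ((2 : ℝ) ^ k)
      rw [one_mul, mul_comm 2 ((2 : ℝ) ^ k), ← zpow_add_one₀ two_ne_zero] at h
      rw [← h, ← intervalIntegral.integral_const_mul]
      refine intervalIntegral.integral_congr fun β _ => ?_
      simp only [one_div, mul_inv]
      field_simp
    simp_rw [hscale]
    rw [Finset.sum_Ico_int_sub n
      (fun k : ℤ => ∫ u in (2 : ℝ) ^ k..2 ^ (0 : ℤ), cappedSq p w u * (1 / u)),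
      hsub, hneg, zpow_natCast]

/-- A linear lower bound for the truncated square of a window of bounded weight. -/
lemma le_cappedSq (p w η : J → ℝ) (hp : ∀ j, 0 < p j) (hη : ∀ j, 0 ≤ η j)
    (hη1 : ∑ j, η j ≤ 1) (hw : ∀ j, p j * η j ≤ w j) {u : ℝ} (hu : 0 ≤ u) :
    1 / 2 * u * windowMass p (fun j => p j * η j) u - u ^ 2 / 16 ≤ cappedSq p w u := by
  have h0 := windowMass_nonneg p (fun j => p j * η j) (fun j => mul_nonneg (hp j).le (hη j)) u
  have h1 := windowMass_size_le p η hη hη1 hu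
  have h2 : min (windowMass p (fun j => p j * η j) u) u ^ 2 ≤ cappedSq p w u :=
    pow_le_pow_left₀ (le_min h0 hu) (min_le_min_right _ (windowMass_mono p hw u)) 2
  refine le_trans ?_ h2
  generalize windowMass p (fun j => p j * η j) u = v at *
  rcases le_total v u with h | h
  · rw [min_eq_left h]
    nlinarith [sq_nonneg (v - u / 4)]
  · rw [min_eq_right h]
    nlinarith

lemma intervalIntegrable_windowMass (p w : J → ℝ) (a b : ℝ) :
    IntervalIntegrable (windowMass p w) volume a b := by
  have hbound : IntervalIntegrable (fun _ : ℝ => ∑ j, |w j|) volume a b :=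
    intervalIntegrable_const
  refine hbound.mono_fun (measurable_windowMass p w).aestronglyMeasurable
    (Filter.Eventually.of_forall fun u => ?_)
  change |windowMass p w u| ≤ abs (∑ j, |w j|)
  rw [abs_of_nonneg (a := ∑ j, |w j|) (Finset.sum_nonneg fun j _ => abs_nonneg _)]
  refine (Finset.abs_sum_le_sum_abs _ _).trans (Finset.sum_le_sum fun j _ => ?_)
  split_ifs <;> simp

lemma le_integral_window {q ε X : ℝ} (hX : ε ≤ X) (hε : ε ≤ q / 2) :
    min q X - q / 2 ≤ ∫ u in ε..X, if u ≤ q ∧ q < 2 * u then (1 : ℝ) else 0 := by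
  have h : ∀ u : ℝ, (if u ≤ q ∧ q < 2 * u then (1 : ℝ) else 0)
      = (Set.Ioc (q / 2) q).indicator (fun _ => 1) u := by
    intro u
    rw [Set.indicator_apply]
    congr 1
    rw [Set.mem_Ioc, eq_iff_iff]
    constructor <;> rintro ⟨h1, h2⟩ <;> constructor <;> linarith
  simp_rw [h]
  rw [intervalIntegral.integral_of_le hX, setIntegral_indicator measurableSet_Ioc,
    Set.Ioc_inter_Ioc, setIntegral_const, smul_eq_mul, mul_one, Real.volume_real_Ioc,
    max_eq_right hε, min_comm X q]
  exact le_max_left _ _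

lemma le_integral_windowMass (p w : J → ℝ) (hw : ∀ j, 0 ≤ w j) {ε X : ℝ} (hX : ε ≤ X)
    (hε : ∀ j, ε ≤ p j / 2) :
    ∑ j, w j * (min (p j) X - p j / 2) ≤ ∫ u in ε..X, windowMass p w u := by
  have h1 : ∀ u, windowMass p w u
      = ∑ j, w j * windowMass (fun _ : Unit => p j) (fun _ => 1) u := by
    intro u
    simp [windowMass]
  simp_rw [h1]
  rw [intervalIntegral.integral_finsetSum
    fun j _ => (intervalIntegrable_windowMass _ _ _ _).const_mul _]
  refine Finset.sum_le_sum fun j _ => ?_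
  rw [intervalIntegral.integral_const_mul]
  refine mul_le_mul_of_nonneg_left ?_ (hw j)
  simpa [windowMass] using le_integral_window hX (hε j)

lemma le_integral_tsum_cappedSq (p w η : J → ℝ) (hp : ∀ j, 0 < p j) (hη : ∀ j, 0 ≤ η j)
    (hη1 : ∑ j, η j ≤ 1) (hw : ∀ j, p j * η j ≤ w j) {X : ℝ} (hX : 0 < X) :
    1 / 2 * ∑ j, p j * η j * (min (p j) X - p j / 2) - X ^ 2 / 32 ≤
      ∫ β in (1 : ℝ)..2, (∑' k : ℤ, cappedSq p w (β * 2 ^ k)) * (1 / β) := by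
  have hw0 : ∀ j, 0 ≤ w j := fun j => (mul_nonneg (hp j).le (hη j)).trans (hw j)
  obtain ⟨δ, hδ, hδX, hδp⟩ : ∃ δ : ℝ, 0 < δ ∧ δ ≤ X ∧ ∀ j, δ ≤ p j / 2 := by
    have h : ∀ {a : ℝ}, 0 < a → ∀ᶠ δ in nhdsWithin 0 (Set.Ioi 0), 0 < δ ∧ δ ≤ a :=
      fun ha => Ioc_mem_nhdsGT ha
    obtain ⟨δ, h1, h2⟩ :=
      ((h hX).and (Filter.eventually_all.2 fun j => h (half_pos (hp j)))).exists
    exact ⟨δ, h1.1, h1.2, fun j => (h2 j).2⟩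
  obtain ⟨ε, T, hε, hεδ, hXT, -, heq⟩ := exists_integral_tsum_cappedSq p w hp hw0 (X := X) hδ
  rw [heq]
  have hεX : ε ≤ X := hεδ.trans hδX
  have hint : ∀ a b : ℝ, 0 < a → 0 < b →
      IntervalIntegrable (fun u => cappedSq p w u * (1 / u)) volume a b := fun a b ha hb => by
    simpa using intervalIntegrable_cappedSq_mul p w hw0 ha hb one_pos
  have hsplit : ∫ u in ε..X, cappedSq p w u * (1 / u) ≤ ∫ u in ε..T, cappedSq p w u * (1 / u) := by
    rw [← intervalIntegral.integral_add_adjacent_intervals (hint ε X hε hX)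
      (hint X T hX (hX.trans_le hXT))]
    have : 0 ≤ ∫ u in X..T, cappedSq p w u * (1 / u) :=
      intervalIntegral.integral_nonneg hXT fun u hu =>
        mul_nonneg (sq_nonneg _) (one_div_nonneg.2 (hX.le.trans hu.1))
    linarith
  have hw' := intervalIntegrable_windowMass p (fun j => p j * η j) ε X
  have hid : IntervalIntegrable (fun u : ℝ => u / 16) volume ε X :=
    (continuous_id.div_const _).intervalIntegrable _ _
  have hle : ∫ u in ε..X, (1 / 2 * windowMass p (fun j => p j * η j) u - u / 16)
      ≤ ∫ u in ε..X, cappedSq p w u * (1 / u) := by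
    refine intervalIntegral.integral_mono_on hεX ((hw'.const_mul _).sub hid) (hint ε X hε hX)
      fun u hu => ?_
    have hu0 : 0 < u := hε.trans_le hu.1
    rw [mul_one_div, le_div_iff₀ hu0]
    refine le_trans (le_of_eq ?_) (le_cappedSq p w η hp hη hη1 hw hu0.le)
    ring
  rw [intervalIntegral.integral_sub (hw'.const_mul _) hid, intervalIntegral.integral_const_mul,
    intervalIntegral.integral_div, integral_id] at hle
  have hmass := le_integral_windowMass p (fun j => p j * η j)
    (fun j => mul_nonneg (hp j).le (hη j)) hεX fun j => hεδ.trans (hδp j)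
  nlinarith [sq_nonneg ε]

end Windows

/-- The pointwise quadratic inequality behind the constant `1.36`. -/
lemma level_quadratic_nonneg {c V m q θ : ℝ} (hc1 : 1.4426 ≤ c) (hc2 : c ≤ 1.4428)
    (hV : 0 < V) (hq : 0 < q) (hθ : θ ≤ V) (hm : m = max θ q) :
    2 * V * m - (1 - 0.045 * c) * V ^ 2 ≤
      1.36 * m ^ 2 - 0.64 * q * m + c * (1 / 2 * (q * (min q (1.2 * V) - q / 2))) := by
  rcases le_total q (1.2 * V) with h | h
  · rw [min_eq_left h]
    have h1 : 0.3606 * q ^ 2 ≤ c / 4 * q ^ 2 := by gcongr; linarith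
    have h2 : 0.045 * c * V ^ 2 ≤ 0.065 * V ^ 2 := by gcongr; linarith
    nlinarith [sq_nonneg (1.36 * m - 0.32 * q - V), sq_nonneg (q - 0.8265 * V)]
  · rw [min_eq_right h]
    have hm' : m = q := by rw [hm]; exact max_eq_right (by linarith)
    rw [hm']
    have h1 : c / 4 * q ^ 2 ≤ 0.3607 * q ^ 2 := by gcongr; linarith
    have h2 : 0.045 * c * V ^ 2 ≤ 0.065 * V ^ 2 := by gcongr; linarith
    have h3 : 0.8655 * (q * V) ≤ 0.6 * c * (q * V) := by gcongr; linarith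
    nlinarith [sq_nonneg (q - 1.5787 * V)]

theorem stmt8 {J : Type*} [Fintype J] [DecidableEq J]
    (p : J → ℝ) (hp : ∀ j, 0 < p j)
    (y : Finset J → ℝ) (hy : ∀ f, 0 ≤ y f) (hy1 : ∑ f, y f = 1)
    (z : J → ℝ) (hz : ∀ j, z j = ∑ f ∈ Finset.univ.filter (fun f => j ∈ f), y f)
    (vol : Finset J → ℝ) (hvol : ∀ S, vol S = ∑ j ∈ S, z j * p j)
    (Jk : ℝ → ℤ → Finset J)
    (hJk : ∀ β k, Jk β k = Finset.univ.filter
        (fun j => β * 2 ^ k ≤ p j ∧ p j < β * 2 ^ (k + 1))) :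
    (1 / Real.log 2) * ∫ β in (1:ℝ)..2,
        (∑ j, z j * p j ^ 2 + 1 / 2 * vol Finset.univ ^ 2 -
          1 / 2 * ∑' k : ℤ, (min (vol (Jk β k)) (β * 2 ^ k)) ^ 2) * (1 / β)
      ≤ 1.36 * (1 / 2) * (∑ j, z j * p j ^ 2 + ∑ f, y f * (∑ j ∈ f, p j) ^ 2) := by
  set w : J → ℝ := fun j => z j * p j with hw
  set V := ∑ j, z j * p j with hV
  set A := ∑ j, z j * p j ^ 2 with hA
  set B := ∑ f, y f * (∑ j ∈ f, p j) ^ 2 with hB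
  have hz0 : ∀ j, 0 ≤ z j := fun j => by
    rw [hz]
    exact Finset.sum_nonneg fun f _ => hy f
  have hw0 : ∀ j, 0 ≤ w j := fun j => mul_nonneg (hz0 j) (hp j).le
  have hV0 : 0 ≤ V := Finset.sum_nonneg fun j _ => hw0 j
  have hvolV : vol Finset.univ = V := hvol _
  have hwin : ∀ (β : ℝ) (k : ℤ),
      min (vol (Jk β k)) (β * 2 ^ k) ^ 2 = cappedSq p w (β * 2 ^ k) := by
    intro β k
    rw [cappedSq, hvol, hJk, Finset.sum_filter, windowMass]
    congr! 5 with j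
    rw [zpow_add_one₀ two_ne_zero]
    ring_nf
  simp_rw [hwin, hvolV]
  set I := ∫ β in (1 : ℝ)..2, (∑' k : ℤ, cappedSq p w (β * 2 ^ k)) * (1 / β) with hI
  have hint : ∫ β in (1 : ℝ)..2,
      (A + 1 / 2 * V ^ 2 - 1 / 2 * ∑' k : ℤ, cappedSq p w (β * 2 ^ k)) * (1 / β) =
      (A + 1 / 2 * V ^ 2) * Real.log 2 - 1 / 2 * I := by
    obtain ⟨-, -, -, -, -, hint, -⟩ :=
      exists_integral_tsum_cappedSq p w hp hw0 (X := 0) one_pos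
    have hinv : IntervalIntegrable (fun β : ℝ => 1 / β) volume 1 2 :=
      intervalIntegral.intervalIntegrable_one_div
        (fun β hβ => by
          rw [Set.uIcc_of_le one_le_two] at hβ
          exact (one_pos.trans_le hβ.1).ne') continuousOn_id
    have hlog : ∫ β in (1 : ℝ)..2, 1 / β = Real.log 2 := by
      rw [integral_one_div_of_pos one_pos two_pos, div_one]
    rw [hI, ← hlog, ← intervalIntegral.integral_const_mul, ← intervalIntegral.integral_const_mul,
      ← intervalIntegral.integral_sub (hinv.const_mul _) (hint.const_mul _)]
    refine intervalIntegral.integral_congr fun β _ => ?_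
    ring
  rw [hint]
  have hlog0 : 0 < Real.log 2 := Real.log_pos one_lt_two
  set c := 1 / Real.log 2 with hc
  have hc1 : 1.4426 ≤ c := by
    rw [hc, le_div_iff₀ hlog0]
    linarith [Real.log_two_lt_d9]
  have hc2 : c ≤ 1.4428 := by
    rw [hc, div_le_iff₀ hlog0]
    linarith [Real.log_two_gt_d9]
  have hclog : c * Real.log 2 = 1 := one_div_mul_cancel hlog0.ne'
  suffices h : A + 1 / 2 * V ^ 2 - 1 / 2 * (c * I) ≤ 1.36 * (1 / 2) * (A + B) by
    linear_combination h + (A + 1 / 2 * V ^ 2) * hclog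
  rcases hV0.eq_or_lt with hV0 | hV0
  · have hI0 : 0 ≤ I := intervalIntegral.integral_nonneg one_le_two fun β hβ =>
      mul_nonneg (tsum_nonneg fun k => sq_nonneg _) (one_div_nonneg.2 (by linarith [hβ.1]))
    have hB0 : 0 ≤ B := Finset.sum_nonneg fun f _ => mul_nonneg (hy f) (sq_nonneg _)
    have hA0 : A = 0 := by
      refine Finset.sum_eq_zero fun j hj => ?_
      have := (Finset.sum_eq_zero_iff_of_nonneg fun j _ => hw0 j).1 hV0.symm j hj
      rw [sq, ← mul_assoc, show z j * p j = 0 from this, zero_mul]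
    rw [hA0, ← hV0]
    have := mul_nonneg (by linarith : (0 : ℝ) ≤ c) hI0
    linarith
  obtain ⟨θ, hθ, hη1, hθη⟩ := exists_level p hp z hV0 hz0
  set m : J → ℝ := fun j => max θ (p j) with hm
  set η : J → ℝ := fun j => w j / m j with hη
  have hm0 : ∀ j, 0 < m j := fun j => lt_max_of_lt_right (hp j)
  have hη0 : ∀ j, 0 ≤ η j := fun j => div_nonneg (hw0 j) (hm0 j).le
  have hmη : ∀ j, m j * η j = w j := fun j => mul_div_cancel₀ _ (hm0 j).ne'
  replace hη1 : ∑ j, η j ≤ 1 := hη1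
  replace hθη : θ = 0 ∨ ∑ j, η j = 1 := hθη
  have hVη : V = ∑ j, m j * η j := Finset.sum_congr rfl fun j _ => (hmη j).symm
  have hAη : A = ∑ j, p j * m j * η j := Finset.sum_congr rfl fun j _ => by
    rw [mul_assoc, hmη]
    ring
  have hθV : θ ≤ V := by
    rcases hθη with h | h
    · exact h.trans_le hV0.le
    · calc θ = ∑ j, θ * η j := by rw [← Finset.mul_sum, h, mul_one]
        _ ≤ V := by
          rw [hVη]
          exact Finset.sum_le_sum fun j _ =>
            mul_le_mul_of_nonneg_right (le_max_left _ _) (hη0 j)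
  have hBη : ∑ j, m j ^ 2 * η j ≤ B := by
    have hswap : ∀ g : J → ℝ, ∑ f, y f * ∑ j ∈ f, g j = ∑ j, z j * g j := by
      intro g
      simp_rw [hz, Finset.sum_mul, Finset.mul_sum, Finset.sum_filter]
      rw [Finset.sum_comm]
      refine Finset.sum_congr rfl fun f _ => ?_
      rw [← Finset.sum_filter]
      exact Finset.sum_congr (by ext; simp) fun _ _ => rfl
    have h1 : ∑ f, y f * (∑ j ∈ f, p j * (m j + θ ^ 2 / m j) - θ ^ 2) ≤ B :=
      Finset.sum_le_sum fun f _ =>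
        mul_le_mul_of_nonneg_left (sum_mul_level_le_sq p hp hθ f) (hy f)
    simp_rw [mul_sub] at h1
    rw [Finset.sum_sub_distrib, hswap, ← Finset.sum_mul, hy1, one_mul] at h1
    have h2 : ∑ j, z j * (p j * (m j + θ ^ 2 / m j)) =
        ∑ j, m j ^ 2 * η j + θ ^ 2 * ∑ j, η j := by
      rw [Finset.mul_sum, ← Finset.sum_add_distrib]
      refine Finset.sum_congr rfl fun j _ => ?_
      have := (hm0 j).ne'
      simp only [hη, hw]
      field_simp
    have h3 : θ ^ 2 * ∑ j, η j = θ ^ 2 := by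
      rcases hθη with h | h
      · simp [h]
      · rw [h, mul_one]
    linarith
  have hIη := le_integral_tsum_cappedSq p w η hp hη0 hη1
    (fun j => (mul_le_mul_of_nonneg_right (le_max_right _ _) (hη0 j)).trans_eq (hmη j))
    (X := 1.2 * V) (by positivity)
  rw [← hI] at hIη
  have hIc := mul_le_mul_of_nonneg_left hIη (by linarith : (0 : ℝ) ≤ c)
  have hsum := Finset.sum_le_sum fun j (_ : j ∈ Finset.univ) =>
    mul_le_mul_of_nonneg_right
      (level_quadratic_nonneg hc1 hc2 hV0 (hp j) hθV (rfl : m j = max θ (p j))) (hη0 j)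
  clear_value V
  have hl : ∑ j, (2 * V * m j - (1 - 0.045 * c) * V ^ 2) * η j =
      2 * V * V - (1 - 0.045 * c) * V ^ 2 * ∑ j, η j := by
    calc _ = 2 * V * ∑ j, m j * η j - (1 - 0.045 * c) * V ^ 2 * ∑ j, η j := by
          rw [Finset.mul_sum, Finset.mul_sum, ← Finset.sum_sub_distrib]
          exact Finset.sum_congr rfl fun j _ => by ring
      _ = _ := by rw [← hVη]
  have hr : ∑ j, (1.36 * m j ^ 2 - 0.64 * p j * m j +
      c * (1 / 2 * (p j * (min (p j) (1.2 * V) - p j / 2)))) * η j =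
      1.36 * ∑ j, m j ^ 2 * η j - 0.64 * A +
        c * (1 / 2 * ∑ j, p j * η j * (min (p j) (1.2 * V) - p j / 2)) := by
    simp only [hAη, Finset.mul_sum]
    rw [← Finset.sum_sub_distrib, ← Finset.sum_add_distrib]
    exact Finset.sum_congr rfl fun j _ => by ring
  rw [hl, hr] at hsum
  have hfac : (1 - 0.045 * c) * V ^ 2 * ∑ j, η j ≤ (1 - 0.045 * c) * V ^ 2 :=
    mul_le_of_le_one_right (mul_nonneg (by linarith) (sq_nonneg V)) hη1
  nlinarith
end

section
/- Let V > 0. For each β ∈ [1, 2), let k(β) ∈ ℤ be the unique integer with β·2^{k(β)} ≤ V/2 < β·2^{k(β)+1}, and define L(β) := V / (β·2^{k(β)}). Then L(β) ∈ [2, 4) for every β ∈ [1,2), and for all reals 2 ≤ c ≤ d ≤ 4: (1/ln 2) · ∫_{{β ∈ [1,2) : c ≤ L(β) < d}} (1/β) dβ = ln(d/c) / ln 2. -/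
open MeasureTheory

lemma setIntegral_Ioc_one_div {a b : ℝ} (ha : 0 < a) (hab : a ≤ b) :
    ∫ x in Set.Ioc a b, 1 / x = Real.log (b / a) := by
  rw [← intervalIntegral.integral_of_le hab, integral_one_div_of_pos ha (ha.trans_le hab)]

lemma integrableOn_Icc_one_div {a b : ℝ} (ha : 0 < a) :
    IntegrableOn (fun x : ℝ => 1 / x) (Set.Icc a b) := by
  apply ContinuousOn.integrableOn_Icc
  intro x hx
  have : x ≠ 0 := (ha.trans_le hx.1).ne'
  exact (continuousAt_const.div continuousAt_id this).continuousWithinAt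

lemma eq_of_mul_two_zpow_le_lt {b x : ℝ} (hb : 0 < b) {i j : ℤ}
    (hi : b * 2 ^ i ≤ x) (hi' : x < b * 2 ^ (i + 1))
    (hj : b * 2 ^ j ≤ x) (hj' : x < b * 2 ^ (j + 1)) : i = j := by
  have h1 : (2 : ℝ) ^ i < 2 ^ (j + 1) := lt_of_mul_lt_mul_left (hi.trans_lt hj') hb.le
  have h2 : (2 : ℝ) ^ j < 2 ^ (i + 1) := lt_of_mul_lt_mul_left (hj.trans_lt hi') hb.le
  rw [zpow_lt_zpow_iff_right₀ (by norm_num)] at h1 h2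
  omega

/-- The integral of `1 / b` over the shifts `b ∈ [1, 2)` with scaled volume `L b` in `[c, d)`, when `L b` is `2 * w / b`
for `b ≤ w` and `4 * w / b` for `b > w`. -/
lemma setIntegral_one_div_of_piecewise {w : ℝ} (hw : 1 ≤ w) (hw2 : w < 2) {L : ℝ → ℝ}
    (hlow : ∀ b, 1 ≤ b → b ≤ w → L b = 2 * w / b)
    (hhigh : ∀ b, w < b → b < 2 → L b = 4 * w / b)
    {c d : ℝ} (hc : 2 ≤ c) (hcd : c ≤ d) (hd : d ≤ 4) :
    ∫ b in {b : ℝ | 1 ≤ b ∧ b < 2 ∧ c ≤ L b ∧ L b < d}, 1 / b = Real.log (d / c) := by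
  have hc0 : 0 < c := by linarith
  have hd0 : 0 < d := by linarith
  have hw0 : 0 < w := by linarith
  have hS : ∀ b : ℝ, (1 ≤ b ∧ b < 2 ∧ c ≤ L b ∧ L b < d) ↔
      (1 ≤ b ∧ 2 * w / d < b ∧ b ≤ 2 * w / c) ∨ (b < 2 ∧ 4 * w / d < b ∧ b ≤ 4 * w / c) := by
    intro b
    rw [div_lt_iff₀ hd0, le_div_iff₀ hc0, div_lt_iff₀ hd0, le_div_iff₀ hc0]
    constructor
    · rintro ⟨h1, h2, h3, h4⟩
      have hb : 0 < b := by linarith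
      rcases le_or_gt b w with h | h
      · rw [hlow b h1 h, le_div_iff₀ hb] at h3
        rw [hlow b h1 h, div_lt_iff₀ hb] at h4
        exact Or.inl ⟨h1, by linarith, by linarith⟩
      · rw [hhigh b h h2, le_div_iff₀ hb] at h3
        rw [hhigh b h h2, div_lt_iff₀ hb] at h4
        exact Or.inr ⟨h2, by linarith, by linarith⟩
    · rintro (⟨h1, h3, h4⟩ | ⟨h2, h3, h4⟩)
      · have hb : 0 < b := by linarith
        have h : b ≤ w := by nlinarith
        rw [hlow b h1 h, le_div_iff₀ hb, div_lt_iff₀ hb]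
        exact ⟨h1, by linarith, by linarith, by linarith⟩
      · have hb : 0 < b := by
          by_contra! hb
          nlinarith
        have h : w < b := by nlinarith
        rw [hhigh b h h2, le_div_iff₀ hb, div_lt_iff₀ hb]
        exact ⟨by linarith, h2, by linarith, by linarith⟩
  simp only [hS]
  rcases le_or_gt d (2 * w) with h | h
  · have h1 : 1 ≤ 2 * w / d := by rwa [le_div_iff₀ hd0, one_mul]
    have h2 : 2 ≤ 4 * w / d := by rw [le_div_iff₀ hd0]; linarith
    have : {b : ℝ | (1 ≤ b ∧ 2 * w / d < b ∧ b ≤ 2 * w / c) ∨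
        (b < 2 ∧ 4 * w / d < b ∧ b ≤ 4 * w / c)} = Set.Ioc (2 * w / d) (2 * w / c) := by
      ext b
      simp only [Set.mem_ofPred_eq, Set.mem_Ioc]
      constructor
      · rintro (h | h)
        · exact h.2
        · linarith
      · exact fun h => Or.inl ⟨by linarith, h⟩
    rw [this, setIntegral_Ioc_one_div (by positivity) (by gcongr)]
    congr 1
    field_simp
  rcases lt_or_ge (2 * w) c with h' | h'
  · have h1 : 2 * w / c < 1 := by rwa [div_lt_iff₀ hc0, one_mul]
    have h2 : 4 * w / c < 2 := by rw [div_lt_iff₀ hc0]; linarith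
    have : {b : ℝ | (1 ≤ b ∧ 2 * w / d < b ∧ b ≤ 2 * w / c) ∨
        (b < 2 ∧ 4 * w / d < b ∧ b ≤ 4 * w / c)} = Set.Ioc (4 * w / d) (4 * w / c) := by
      ext b
      simp only [Set.mem_ofPred_eq, Set.mem_Ioc]
      constructor
      · rintro (h | h)
        · linarith
        · exact h.2
      · exact fun h => Or.inr ⟨by linarith, h⟩
    rw [this, setIntegral_Ioc_one_div (by positivity) (by gcongr)]
    congr 1
    field_simp
  · have h1 : 2 * w / d < 1 := by rwa [div_lt_iff₀ hd0, one_mul]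
    have h2 : 1 ≤ 2 * w / c := by rwa [le_div_iff₀ hc0, one_mul]
    have h3 : 4 * w / d < 2 := by rw [div_lt_iff₀ hd0]; linarith
    have h4 : 2 ≤ 4 * w / c := by rw [le_div_iff₀ hc0]; linarith
    have h5 : 2 * w / c ≤ w := by rw [div_le_iff₀ hc0]; nlinarith
    have h6 : w ≤ 4 * w / d := by rw [le_div_iff₀ hd0]; nlinarith
    have : {b : ℝ | (1 ≤ b ∧ 2 * w / d < b ∧ b ≤ 2 * w / c) ∨
        (b < 2 ∧ 4 * w / d < b ∧ b ≤ 4 * w / c)} =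
        Set.Icc 1 (2 * w / c) ∪ Set.Ioo (4 * w / d) 2 := by
      ext b
      simp only [Set.mem_ofPred_eq, Set.mem_union, Set.mem_Icc, Set.mem_Ioo]
      constructor
      · rintro (h | h)
        · exact Or.inl ⟨h.1, h.2.2⟩
        · exact Or.inr ⟨h.2.1, h.1⟩
      · rintro (h | h)
        · exact Or.inl ⟨h.1, by linarith, h.2⟩
        · exact Or.inr ⟨h.2, h.1, by linarith⟩
    have hdisj : Disjoint (Set.Icc 1 (2 * w / c)) (Set.Ioo (4 * w / d) 2) := by
      rw [Set.disjoint_left]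
      intro b hb hb'
      linarith [hb.2, hb'.1]
    have hpos : 0 < 4 * w / d := by positivity
    rw [this, setIntegral_union hdisj measurableSet_Ioo (integrableOn_Icc_one_div one_pos)
      ((integrableOn_Icc_one_div hpos).mono_set Set.Ioo_subset_Icc_self),
      integral_Icc_eq_integral_Ioc, ← integral_Ioc_eq_integral_Ioo,
      setIntegral_Ioc_one_div one_pos h2, setIntegral_Ioc_one_div hpos h3.le,
      ← Real.log_mul (by positivity) (by positivity)]
    congr 1
    field_simp
    norm_num

theorem stmt14 (V : ℝ) (hV : 0 < V) (k : ℝ → ℤ)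
    (hk : ∀ β : ℝ, 1 ≤ β → β < 2 →
      β * 2 ^ (k β) ≤ V / 2 ∧ V / 2 < β * 2 ^ (k β + 1))
    (L : ℝ → ℝ) (hL : ∀ β, L β = V / (β * 2 ^ (k β))) :
    (∀ β : ℝ, 1 ≤ β → β < 2 → 2 ≤ L β ∧ L β < 4) ∧
      ∀ c d : ℝ, 2 ≤ c → c ≤ d → d ≤ 4 →
        (1 / Real.log 2) *
            ∫ β in {β : ℝ | 1 ≤ β ∧ β < 2 ∧ c ≤ L β ∧ L β < d}, (1 / β) =
          Real.log (d / c) / Real.log 2 := by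
  constructor
  · intro β h1 h2
    obtain ⟨hle, hlt⟩ := hk β h1 h2
    rw [zpow_add_one₀ two_ne_zero] at hlt
    have hpos : 0 < β * 2 ^ k β := by positivity
    rw [hL, le_div_iff₀ hpos, div_lt_iff₀ hpos]
    constructor <;> linarith
  · intro c d hc hcd hd
    obtain ⟨hle, hlt⟩ := hk 1 le_rfl one_lt_two
    rw [zpow_add_one₀ two_ne_zero] at hlt
    set p : ℝ := 2 ^ k 1 with hp
    have hp0 : 0 < p := by positivity
    set w : ℝ := V / 2 / p with hw
    have hVw : V = 2 * w * p := by rw [hw]; field_simp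
    have hw1 : 1 ≤ w := by rw [hw, le_div_iff₀ hp0]; linarith
    have hw2 : w < 2 := by rw [hw, div_lt_iff₀ hp0]; linarith
    rw [setIntegral_one_div_of_piecewise hw1 hw2 _ _ hc hcd hd]
    · ring
    · intro b hb1 hbw
      have hb0 : 0 < b := by linarith
      obtain ⟨hble, hblt⟩ := hk b hb1 (by linarith)
      have hkb : k b = k 1 := by
        refine eq_of_mul_two_zpow_le_lt hb0 hble hblt ?_ ?_
        · rw [← hp]; nlinarith
        · rw [zpow_add_one₀ two_ne_zero, ← hp]; nlinarith
      rw [hL, hkb, ← hp, hVw]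
      field_simp
    · intro b hwb hb2
      have hb0 : 0 < b := by linarith
      obtain ⟨hble, hblt⟩ := hk b (by linarith) hb2
      have hkb : k b = k 1 - 1 := by
        refine eq_of_mul_two_zpow_le_lt hb0 hble hblt ?_ ?_
        · rw [zpow_sub_one₀ two_ne_zero, ← hp]; nlinarith
        · rw [sub_add_cancel, ← hp]; nlinarith
      rw [hL, hkb, zpow_sub_one₀ two_ne_zero, ← hp, hVw]
      field_simp
      norm_num
end
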